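/- arXiv:1912.04788 — 3 statements merged into one kernel-verified Lean document; each statement's English description precedes it below -/
import Mathlib

section
/- Let k be a field, f₁,…,fₙ ∈ k[x₁,…,xₙ], and let p be a prime ideal of k[x₁,…,xₙ] containing f₁,…,fₙ such that the residue field L = κ(p) is a finite separable extension of k. Assume p is an isolated point of the zero locus Z = V(f₁,…,fₙ) ⊆ Spec k[x₁,…,xₙ], i.e., {p} is open in Z with its subspace topology. Let p̃ ⊆ L[x₁,…,xₙ] be the kernel of the L-algebra map L[x₁,…,xₙ] → L sending each xᵢ to the residue of xᵢ in L. Then p̃ is an isolated point of the zero locus Z_L = V(f₁^L,…,fₙ^L) ⊆ Spec L[x₁,…,xₙ]. That is, the base-changed system f_L has an isolated L-rational zero at p̃. -/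
/-- The residue field `κ(p)` of a prime ideal `p`, i.e. the fraction field of `R ⧸ p`. -/
def residueFieldOfPrime {R : Type} [CommRing R] (p : Ideal R) : Type :=
  FractionRing (R ⧸ p)

noncomputable instance {R : Type} [CommRing R] (p : Ideal R) [p.IsPrime] :
    Field (residueFieldOfPrime p) :=
  inferInstanceAs (Field (FractionRing (R ⧸ p)))

/-- The canonical map `R → κ(p)`. -/
noncomputable def toResidueFieldOfPrime {R : Type} [CommRing R] (p : Ideal R) [p.IsPrime] :
    R →+* residueFieldOfPrime p :=
  (algebraMap (R ⧸ p) (FractionRing (R ⧸ p))).comp (Ideal.Quotient.mk p)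

/-- For `R` an algebra over `S`, the residue field `κ(p)` of a prime `p ⊆ R` is an
`S`-algebra via the canonical map `S → R → κ(p)`. -/
noncomputable instance {S R : Type} [CommRing S] [CommRing R] [Algebra S R]
    (p : Ideal R) [p.IsPrime] : Algebra S (residueFieldOfPrime p) :=
  ((toResidueFieldOfPrime p).comp (algebraMap S R)).toAlgebra

/-- Given a prime `p ⊆ k[x₁,…,xₙ]`, the point `p̃` of affine `n`-space over `κ(p)`:
the kernel of the `κ(p)`-algebra map `κ(p)[x₁,…,xₙ] → κ(p)` sending `xᵢ` to the residue
of `xᵢ`. -/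
noncomputable def canonicalPointAbove {k : Type} [Field k] {n : ℕ}
    (p : Ideal (MvPolynomial (Fin n) k)) [p.IsPrime] :
    Ideal (MvPolynomial (Fin n) (residueFieldOfPrime p)) :=
  RingHom.ker (MvPolynomial.aeval
    (R := residueFieldOfPrime p)
    (fun i => toResidueFieldOfPrime p (MvPolynomial.X i))).toRingHom

/-- An isolated point `P` of a closed subset of `Spec R` stays isolated after pulling back along a
quasi-finite algebra: every prime lying over `P` is isolated. -/
theorem isOpen_setOf_asIdeal_eq_of_comap_eq {R S : Type*} [CommRing R] [CommRing S] [Algebra R S]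
    [Algebra.QuasiFinite R S] {s : Set R} {t : Set S} (hst : Set.MapsTo (algebraMap R S) s t)
    {P : Ideal R} {Q : Ideal S} (hQ : Q.comap (algebraMap R S) = P)
    (h : IsOpen {x : PrimeSpectrum.zeroLocus s | x.1.asIdeal = P}) :
    IsOpen {x : PrimeSpectrum.zeroLocus t | x.1.asIdeal = Q} := by
  by_cases hprime : Q.IsPrime
  · let q : PrimeSpectrum S := ⟨Q, hprime⟩
    obtain ⟨V, hV, hVq⟩ := (isDiscrete_iff_forall_mem_exists_isOpen.mp
      (Algebra.QuasiFinite.isDiscrete_comap_preimage_singleton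
        (PrimeSpectrum.comap (algebraMap R S) q))) q rfl
    let g : PrimeSpectrum.zeroLocus t → PrimeSpectrum.zeroLocus s := fun x =>
      ⟨PrimeSpectrum.comap (algebraMap R S) x.1, fun a ha => x.2 (hst ha)⟩
    have hg : Continuous g :=
      ((PrimeSpectrum.continuous_comap _).comp continuous_subtype_val).subtype_mk _
    convert! (h.preimage hg).inter (hV.preimage continuous_subtype_val) using 1
    ext x
    have hx : x.1 ∈ V ∩ PrimeSpectrum.comap (algebraMap R S) ⁻¹'
        {PrimeSpectrum.comap (algebraMap R S) q} ↔ x.1.asIdeal = Q := by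
      rw [hVq, Set.mem_singleton_iff, PrimeSpectrum.ext_iff]
    rw [Set.mem_ofPred_eq, ← hx, Set.mem_inter_iff, Set.mem_inter_iff, and_comm]
    refine and_congr ?_ Iff.rfl
    subst hQ
    rw [Set.mem_preimage, Set.mem_singleton_iff, PrimeSpectrum.ext_iff]
    rfl
  · convert isOpen_empty
    exact Set.eq_empty_of_forall_notMem fun x hx => hprime (hx ▸ x.1.2)

section

attribute [local instance] MvPolynomial.algebraMvPolynomial

theorem MvPolynomial.finite_mvPolynomial_of_finite (R S σ : Type*) [CommRing R] [CommRing S]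
    [Algebra R S] [Module.Finite R S] : Module.Finite (MvPolynomial σ R) (MvPolynomial σ S) :=
  .equiv (Algebra.IsPushout.equiv R (MvPolynomial σ R) S (MvPolynomial σ S)).toLinearEquiv

end

theorem comap_canonicalPointAbove {k : Type} [Field k] {n : ℕ}
    (p : Ideal (MvPolynomial (Fin n) k)) [p.IsPrime] :
    (canonicalPointAbove p).comap (MvPolynomial.map (algebraMap k (residueFieldOfPrime p))) =
      p := by
  have hcomp : (MvPolynomial.aeval (R := residueFieldOfPrime p)
      (fun i => toResidueFieldOfPrime p (MvPolynomial.X i))).toRingHom.comp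
        (MvPolynomial.map (algebraMap k (residueFieldOfPrime p))) =
      toResidueFieldOfPrime p := by
    ext x
    · simp [RingHom.algebraMap_toAlgebra, MvPolynomial.algebraMap_eq]
    · simp
  rw [canonicalPointAbove, RingHom.comap_ker, hcomp]
  ext x
  rw [RingHom.mem_ker, ← Ideal.Quotient.eq_zero_iff_mem]
  exact IsFractionRing.to_map_eq_zero_iff (R := MvPolynomial (Fin n) k ⧸ p)
    (K := FractionRing (MvPolynomial (Fin n) k ⧸ p))

/-- Let `p ⊆ k[x₁,…,xₙ]` be a prime containing `f₁,…,fₙ` whose residue field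
`L = κ(p)` is a finite separable extension of `k`, and assume `p` is an isolated point
of the zero locus `V(f₁,…,fₙ) ⊆ Spec k[x₁,…,xₙ]`.  Then the canonical `L`-rational
point `p̃` above `p` is an isolated point of the zero locus `V(f₁^L,…,fₙ^L)` of the
base-changed system. -/
theorem isolated_zero_base_change
    (k : Type) [Field k] (n : ℕ) (f : Fin n → MvPolynomial (Fin n) k)
    (p : Ideal (MvPolynomial (Fin n) k)) [p.IsPrime] (hfp : ∀ i, f i ∈ p)
    [FiniteDimensional k (residueFieldOfPrime p)]
    [Algebra.IsSeparable k (residueFieldOfPrime p)]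
    (hiso : IsOpen {x : PrimeSpectrum.zeroLocus (Set.range f) | x.1.asIdeal = p}) :
    IsOpen {x : PrimeSpectrum.zeroLocus
        (Set.range fun i =>
          MvPolynomial.map (algebraMap k (residueFieldOfPrime p)) (f i)) |
      x.1.asIdeal = canonicalPointAbove p} := by
  let : Algebra (MvPolynomial (Fin n) k) (MvPolynomial (Fin n) (residueFieldOfPrime p)) :=
    MvPolynomial.algebraMvPolynomial
  have := MvPolynomial.finite_mvPolynomial_of_finite k (residueFieldOfPrime p) (Fin n)
  refine isOpen_setOf_asIdeal_eq_of_comap_eq ?_ (comap_canonicalPointAbove p) hiso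
  rintro _ ⟨i, rfl⟩
  exact ⟨i, rfl⟩
end

section
/- Let k be a field, f₁,…,fₙ ∈ k[x₁,…,xₙ], and let p be a prime ideal of k[x₁,…,xₙ] containing f₁,…,fₙ that is an isolated point of the zero locus V(f₁,…,fₙ) ⊆ Spec k[x₁,…,xₙ]. Then the local algebra Q = (k[x₁,…,xₙ]/(f₁,…,fₙ))_p, the localization of k[x₁,…,xₙ]/(f₁,…,fₙ) at the prime corresponding to p, is a finite-dimensional k-vector space. -/
/-- A local ring of a finite type algebra over a field at an isolated point of the spectrum is
finite-dimensional. -/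
theorem finiteDimensional_localization_of_isOpen_singleton {k R : Type*} [Field k] [CommRing R]
    [Algebra k R] [Algebra.FiniteType k R] (q : Ideal R) [hq : q.IsPrime]
    (h : IsOpen {(⟨q, hq⟩ : PrimeSpectrum R)}) :
    FiniteDimensional k (Localization.AtPrime q) := by
  have : Algebra.QuasiFiniteAt k q := .of_isOpen_singleton ⟨q, hq⟩ h
  exact Module.Finite.of_quasiFinite

/-- If the points of the zero locus of `s` whose ideal is `p` form an open subset of it, then the
image of `p` is an isolated point of the spectrum of the quotient by the ideal spanned by `s`. -/
theorem isOpen_singleton_map_quotient_span {R : Type*} [CommRing R] (s : Set R) (p : Ideal R)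
    (hsp : s ⊆ p) [hq : (p.map (Ideal.Quotient.mk (Ideal.span s))).IsPrime]
    (h : IsOpen {x : PrimeSpectrum.zeroLocus s | x.1.asIdeal = p}) :
    IsOpen {(⟨p.map (Ideal.Quotient.mk (Ideal.span s)), hq⟩ :
      PrimeSpectrum (R ⧸ Ideal.span s))} := by
  let π := Ideal.Quotient.mk (Ideal.span s)
  have hπ : Function.Surjective π := Ideal.Quotient.mk_surjective
  have hmem (y : PrimeSpectrum (R ⧸ Ideal.span s)) :
      PrimeSpectrum.comap π y ∈ PrimeSpectrum.zeroLocus s := by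
    have := Set.mem_range_self (f := PrimeSpectrum.comap π) y
    rwa [range_comap_of_surjective _ _ hπ, Ideal.mk_ker,
      PrimeSpectrum.zeroLocus_span] at this
  have hcont : Continuous fun y ↦ (⟨PrimeSpectrum.comap π y, hmem y⟩ :
      PrimeSpectrum.zeroLocus s) :=
    (PrimeSpectrum.continuous_comap π).subtype_mk hmem
  convert h.preimage hcont using 1
  ext y
  simp only [Set.mem_singleton_iff, Set.mem_preimage, Set.mem_ofPred_eq, PrimeSpectrum.ext_iff,
    PrimeSpectrum.comap_asIdeal]
  constructor
  · intro hy
    rw [hy, Ideal.comap_map_of_surjective' π hπ, Ideal.mk_ker, sup_eq_left]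
    exact Ideal.span_le.mpr hsp
  · rintro rfl
    exact (Ideal.map_comap_of_surjective π hπ _).symm


/-- Let `p ⊆ k[x₁,…,xₙ]` be a prime containing `f₁,…,fₙ` which is an isolated point of
the zero locus `V(f₁,…,fₙ) ⊆ Spec k[x₁,…,xₙ]`.  Then the local algebra
`Q = (k[x₁,…,xₙ]/(f₁,…,fₙ))_p`, i.e. the localization of the quotient ring at the prime
corresponding to `p`, is a finite-dimensional `k`-vector space. -/
theorem local_algebra_finite_dimensional
    (k : Type) [Field k] (n : ℕ) (f : Fin n → MvPolynomial (Fin n) k)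
    (p : Ideal (MvPolynomial (Fin n) k)) [p.IsPrime] (hfp : ∀ i, f i ∈ p)
    (hiso : IsOpen {x : PrimeSpectrum.zeroLocus (Set.range f) | x.1.asIdeal = p}) :
    haveI hq : (p.map (Ideal.Quotient.mk (Ideal.span (Set.range f)))).IsPrime :=
      Ideal.map_isPrime_of_surjective Ideal.Quotient.mk_surjective
        (by rw [Ideal.mk_ker]; exact Ideal.span_le.mpr (Set.range_subset_iff.mpr hfp))
    letI Q := Localization.AtPrime (p.map (Ideal.Quotient.mk (Ideal.span (Set.range f))))
    letI : Algebra k Q :=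
      ((algebraMap (MvPolynomial (Fin n) k ⧸ Ideal.span (Set.range f)) Q).comp
        (algebraMap k (MvPolynomial (Fin n) k ⧸ Ideal.span (Set.range f)))).toAlgebra
    FiniteDimensional k Q := by
  have hq : (p.map (Ideal.Quotient.mk (Ideal.span (Set.range f)))).IsPrime :=
    Ideal.map_isPrime_of_surjective Ideal.Quotient.mk_surjective
      (by rw [Ideal.mk_ker]; exact Ideal.span_le.mpr (Set.range_subset_iff.mpr hfp))
  have key := finiteDimensional_localization_of_isOpen_singleton (k := k) _
    (isOpen_singleton_map_quotient_span _ p (Set.range_subset_iff.mpr hfp) hiso)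
  convert key
end

section
/- Let k be a field, f₁,…,fₙ ∈ k[x₁,…,xₙ], and let p be a prime ideal of k[x₁,…,xₙ] containing f₁,…,fₙ that is an isolated point of the zero locus V(f₁,…,fₙ) ⊆ Spec k[x₁,…,xₙ], and suppose the residue field L = κ(p) is a finite separable extension of k. Let p̃ ⊆ L[x₁,…,xₙ] be the kernel of the L-algebra map L[x₁,…,xₙ] → L sending each xᵢ to the residue of xᵢ in L, and let f₁^L,…,fₙ^L be the base-changed polynomials. Let Q = (k[x₁,…,xₙ]/(f₁,…,fₙ))_p and Q̃ = (L[x₁,…,xₙ]/(f₁^L,…,fₙ^L))_{p̃} be the respective local algebras. Then dim_k Q = [L:k] · dim_L Q̃. (This is the equality of ranks of the two sides of the identity deg_p^{A¹} f = Tr_{L/k} deg_{p̃}^{A¹} f_L in GW(k).) -/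
instance {k : Type} [Field k] {n : ℕ} (p : Ideal (MvPolynomial (Fin n) k)) [p.IsPrime] :
    (canonicalPointAbove p).IsPrime :=
  RingHom.ker_isPrime _

/-- If `f i ∈ p` then the base change of `f i` to `κ(p)` vanishes at the canonical point
`p̃` above `p`. -/
theorem map_mem_canonicalPointAbove {k : Type} [Field k] {n : ℕ}
    {f : Fin n → MvPolynomial (Fin n) k}
    (p : Ideal (MvPolynomial (Fin n) k)) [p.IsPrime] (hfp : ∀ i, f i ∈ p) (i : Fin n) :
    MvPolynomial.map (algebraMap k (residueFieldOfPrime p)) (f i) ∈ canonicalPointAbove p := by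
  rw [canonicalPointAbove, RingHom.mem_ker, AlgHom.toRingHom_eq_coe, RingHom.coe_coe,
    MvPolynomial.aeval_map_algebraMap, MvPolynomial.aeval_def]
  have h := MvPolynomial.eval₂_comp_left (toResidueFieldOfPrime p)
    MvPolynomial.C MvPolynomial.X (f i)
  rw [MvPolynomial.eval₂_eta] at h
  rw [show (algebraMap k (residueFieldOfPrime p)) =
      (toResidueFieldOfPrime p).comp MvPolynomial.C from rfl]
  simp only [Function.comp_def] at h
  rw [← h]
  show (algebraMap (MvPolynomial (Fin n) k ⧸ p) (FractionRing (MvPolynomial (Fin n) k ⧸ p)))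
      (Ideal.Quotient.mk p (f i)) = 0
  rw [Ideal.Quotient.eq_zero_iff_mem.mpr (hfp i), map_zero]

section LocalQuotient

variable {R : Type*} [CommRing R] {I p : Ideal R}

theorem mk_notMem_map_quotientMk (hI : I ≤ p) {x : R} (hx : x ∉ p) :
    Ideal.Quotient.mk I x ∉ p.map (Ideal.Quotient.mk I) := by
  rwa [← Ideal.mem_comap, Ideal.comap_map_of_surjective _ Ideal.Quotient.mk_surjective,
    ← RingHom.ker_eq_comap_bot, Ideal.mk_ker, sup_of_le_left hI]

variable (Q : Type*) [CommRing Q] [Algebra (R ⧸ I) Q] [(p.map (Ideal.Quotient.mk I)).IsPrime]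
  [IsLocalization.AtPrime Q (p.map (Ideal.Quotient.mk I))]

/-- The local ring at `p` of the closed subscheme `I` of `Spec R` maps to `S` as soon as `R` does,
killing `I` and inverting the complement of `p`. -/
theorem exists_ringHom_of_quotient_localization {S : Type*} [CommRing S] (g : R →+* S)
    (hg : ∀ x ∈ I, g x = 0) (hu : ∀ x ∉ p, IsUnit (g x)) :
    ∃ h : Q →+* S, ∀ x, h (algebraMap (R ⧸ I) Q (Ideal.Quotient.mk I x)) = g x := by
  have H : ∀ y : (p.map (Ideal.Quotient.mk I)).primeCompl,
      IsUnit (Ideal.Quotient.lift I g hg y) := by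
    rintro ⟨y, hy⟩
    obtain ⟨x, rfl⟩ := Ideal.Quotient.mk_surjective y
    exact hu x fun hx => hy (Ideal.mem_map_of_mem _ hx)
  exact ⟨IsLocalization.lift H, fun x => by rw [IsLocalization.lift_eq, Ideal.Quotient.lift_mk]⟩

variable {Q}

theorem ringHom_ext_of_quotient_localization (p : Ideal R)
    [(p.map (Ideal.Quotient.mk I)).IsPrime]
    [IsLocalization.AtPrime Q (p.map (Ideal.Quotient.mk I))] {S : Type*} [CommRing S] {g h : Q →+* S}
    (H : ∀ x, g (algebraMap (R ⧸ I) Q (Ideal.Quotient.mk I x)) =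
      h (algebraMap (R ⧸ I) Q (Ideal.Quotient.mk I x))) : g = h := by
  refine IsLocalization.ringHom_ext (p.map (Ideal.Quotient.mk I)).primeCompl ?_
  ext x
  exact H x

variable (Q)

/-- If `p` is an isolated point of the zero locus of `I`, then the maximal ideal of the local
ring of this zero locus at `p` is nilpotent. -/
theorem isNilpotent_maximalIdeal_of_isOpen [IsNoetherianRing R] [p.IsPrime] (hI : I ≤ p)
    {s : Set R} (hs : Ideal.span s = I)
    (hiso : IsOpen {x : PrimeSpectrum.zeroLocus s | x.1.asIdeal = p}) [IsLocalRing Q] :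
    IsNilpotent (IsLocalRing.maximalIdeal Q) := by
  have : IsNoetherianRing Q :=
    IsLocalization.isNoetherianRing (p.map (Ideal.Quotient.mk I)).primeCompl Q inferInstance
  rw [Ideal.FG.isNilpotent_iff_le_nilradical (IsNoetherian.noetherian _), nilradical_eq_sInf,
    le_sInf_iff]
  intro P (hP : P.IsPrime)
  let j : R →+* Q := (algebraMap (R ⧸ I) Q).comp (Ideal.Quotient.mk I)
  have hunit : ∀ x ∉ p, IsUnit (j x) := fun x hx =>
    IsLocalization.map_units Q
      (⟨_, mk_notMem_map_quotientMk hI hx⟩ : (p.map (Ideal.Quotient.mk I)).primeCompl)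
  have hjs : ∀ x ∈ s, x ∈ P.comap j := fun x hx => by
    have : Ideal.Quotient.mk I x = 0 :=
      Ideal.Quotient.eq_zero_iff_mem.2 (hs ▸ Ideal.subset_span hx)
    simp [j, Ideal.mem_comap, this]
  have hPp : P.comap j ≤ p := fun x hx => by
    by_contra hxp
    exact hP.ne_top (Ideal.eq_top_of_isUnit_mem _ hx (hunit x hxp))
  let a : PrimeSpectrum.zeroLocus s := ⟨⟨P.comap j, inferInstance⟩, hjs⟩
  let b : PrimeSpectrum.zeroLocus s :=
    ⟨⟨p, inferInstance⟩, fun x hx => hI (hs ▸ Ideal.subset_span hx)⟩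
  have hab : a ⤳ b := by
    rw [Topology.IsInducing.subtypeVal.specializes_iff.symm, ← PrimeSpectrum.le_iff_specializes]
    exact hPp
  have hPeq : P.comap j = p := hab.mem_open hiso (show b ∈ {x | x.1.asIdeal = p} from rfl)
  intro q hq
  obtain ⟨y, t, rfl⟩ := IsLocalization.exists_mk'_eq (p.map (Ideal.Quotient.mk I)).primeCompl q
  obtain ⟨x, rfl⟩ := Ideal.Quotient.mk_surjective y
  have hjx : j x ∈ IsLocalRing.maximalIdeal Q := by
    have := Ideal.mul_mem_right (algebraMap (R ⧸ I) Q t) _ hq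
    rwa [IsLocalization.mk'_spec] at this
  have hxp : x ∈ P.comap j := by
    rw [hPeq]
    by_contra hx
    exact (IsLocalRing.mem_maximalIdeal _).1 hjx (hunit x hx)
  rw [IsLocalization.mk'_eq_mul_mk'_one]
  exact Ideal.mul_mem_right _ _ hxp

end LocalQuotient

/-- Let `Q` be a local `k`-algebra with nilpotent maximal ideal whose residue field `L` is separable
over `k`, and let `Q'` be a noetherian local `L`-algebra with residue field `L` under `Q`, which
has the universal property of the local ring of `L ⊗[k] Q` at its canonical `L`-point.
Then the dimension of `Q` over `k` is `[L : k]` times that of `Q'` over `L`. -/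
theorem finrank_eq_finrank_mul_finrank_of_section {k L Q Q' : Type*} [Field k] [Field L]
    [Algebra k L] [Algebra.IsSeparable k L] [CommRing Q] [IsLocalRing Q] [Algebra k Q] [CommRing Q']
    [IsLocalRing Q'] [IsNoetherianRing Q'] [Algebra L Q']
    (hQ : IsNilpotent (IsLocalRing.maximalIdeal Q))
    (π : Q →ₐ[k] L) (hπ : Function.Surjective π) (π' : Q' →ₐ[L] L) (φ : Q →+* Q')
    (hφ : ∀ c, φ (algebraMap k Q c) = algebraMap L Q' (algebraMap k L c))
    (hπφ : ∀ x, π' (φ x) = π x)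
    (hψ : ∀ s : L →ₐ[k] Q, (∀ l, π (s l) = l) →
      ∃ ψ : Q' →+* Q, (∀ l, ψ (algebraMap L Q' l) = s l) ∧ ∀ x, ψ (φ x) = x)
    (hext : ∀ g : Q' →+* Q', (∀ l, g (algebraMap L Q' l) = algebraMap L Q' l) →
      (∀ x, g (φ x) = φ x) → g = RingHom.id Q') :
    Module.finrank k Q = Module.finrank k L * Module.finrank L Q' := by
  have : Algebra.FormallyEtale k L := Algebra.FormallyEtale.of_isSeparable k L
  let : Algebra k Q' := ((algebraMap L Q').comp (algebraMap k L)).toAlgebra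
  have : IsScalarTower k L Q' := IsScalarTower.of_algebraMap_eq fun _ => rfl
  have hker : IsNilpotent (RingHom.ker (π : Q →+* L)) := by
    rwa [IsLocalRing.eq_maximalIdeal (RingHom.ker_isMaximal_of_surjective (π : Q →+* L) hπ)]
  let s : L →ₐ[k] Q := Algebra.FormallySmooth.liftOfSurjective (AlgHom.id k L) π hπ hker
  have hs : ∀ l, π (s l) = l :=
    Algebra.FormallySmooth.liftOfSurjective_apply (AlgHom.id k L) π hπ hker
  obtain ⟨ψ, hψs, hψφ⟩ := hψ s hs
  let φ' : Q →ₐ[k] Q' := { φ with commutes' := hφ }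
  have hsection : φ'.comp s = IsScalarTower.toAlgHom k L Q' := by
    have hne : RingHom.ker π' ≠ ⊤ := RingHom.ker_ne_top _
    refine Algebra.FormallyUnramified.ext_of_iInf (RingHom.ker π')
      (Ideal.iInf_pow_eq_bot_of_isLocalRing _ hne) fun l => ?_
    rw [Ideal.Quotient.eq, RingHom.mem_ker, map_sub, sub_eq_zero]
    change π' (φ (s l)) = π' (algebraMap L Q' l)
    rw [hπφ, hs, π'.commutes]
    rfl
  have hφψ : φ.comp ψ = RingHom.id Q' := hext _
    (fun l => by rw [RingHom.comp_apply, hψs]; exact DFunLike.congr_fun hsection l)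
    (fun x => by rw [RingHom.comp_apply, hψφ])
  let : Algebra L Q := s.toRingHom.toAlgebra
  have : IsScalarTower k L Q := IsScalarTower.of_algebraMap_eq fun c => (s.commutes c).symm
  let e : Q' ≃ₐ[L] Q :=
    { RingEquiv.ofRingHom ψ φ (RingHom.ext hψφ) hφψ with commutes' := hψs }
  rw [e.toLinearEquiv.finrank_eq, Module.finrank_mul_finrank]

theorem toResidueFieldOfPrime_eq_zero_iff {R : Type} [CommRing R] {p : Ideal R} [p.IsPrime] {x : R} :
    toResidueFieldOfPrime p x = 0 ↔ x ∈ p := by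
  rw [← Ideal.Quotient.eq_zero_iff_mem]
  exact IsFractionRing.to_map_eq_zero_iff (R := R ⧸ p) (K := FractionRing (R ⧸ p))

theorem exists_toResidueFieldOfPrime_mul_eq {R : Type} [CommRing R] {p : Ideal R} [p.IsPrime]
    (l : residueFieldOfPrime p) :
    ∃ x, ∃ y ∉ p, l * toResidueFieldOfPrime p y = toResidueFieldOfPrime p x := by
  obtain ⟨x, y, hy, h⟩ := IsFractionRing.div_surjective (A := R ⧸ p) (K := FractionRing (R ⧸ p)) l
  obtain ⟨x, rfl⟩ := Ideal.Quotient.mk_surjective x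
  obtain ⟨y, rfl⟩ := Ideal.Quotient.mk_surjective y
  have hyp : y ∉ p := fun hyp =>
    nonZeroDivisors.ne_zero hy (Ideal.Quotient.eq_zero_iff_mem.2 hyp)
  refine ⟨x, y, hyp, ?_⟩
  have hy0 : toResidueFieldOfPrime p y ≠ 0 := mt toResidueFieldOfPrime_eq_zero_iff.1 hyp
  have h' : toResidueFieldOfPrime p x / toResidueFieldOfPrime p y = l := h
  rw [← h', div_mul_cancel₀ _ hy0]

/-- The equality of ranks, for local algebras given up to isomorphism. -/
theorem finrank_eq_finrank_mul_finrank_of_isLocalization {k : Type} [Field k] {n : ℕ}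
    {f : Fin n → MvPolynomial (Fin n) k}
    {p : Ideal (MvPolynomial (Fin n) k)} [p.IsPrime]
    [Algebra.IsSeparable k (residueFieldOfPrime p)]
    (hiso : IsOpen {x : PrimeSpectrum.zeroLocus (Set.range f) | x.1.asIdeal = p})
    {I : Ideal (MvPolynomial (Fin n) k)} (hI : Ideal.span (Set.range f) = I) (hIp : I ≤ p)
    {I' : Ideal (MvPolynomial (Fin n) (residueFieldOfPrime p))}
    (hI' : Ideal.span (Set.range fun i =>
      MvPolynomial.map (algebraMap k (residueFieldOfPrime p)) (f i)) = I')
    (hIp' : I' ≤ canonicalPointAbove p)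
    {_ : (p.map (Ideal.Quotient.mk I)).IsPrime}
    {_ : ((canonicalPointAbove p).map (Ideal.Quotient.mk I')).IsPrime}
    {Q Q' : Type*} [CommRing Q] [CommRing Q']
    [Algebra (MvPolynomial (Fin n) k ⧸ I) Q]
    [Algebra (MvPolynomial (Fin n) (residueFieldOfPrime p) ⧸ I') Q']
    [IsLocalization.AtPrime Q (p.map (Ideal.Quotient.mk I))]
    [IsLocalization.AtPrime Q' ((canonicalPointAbove p).map (Ideal.Quotient.mk I'))]
    {_ : Algebra k Q} {_ : Algebra (residueFieldOfPrime p) Q'}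
    (hkQ : ∀ c, algebraMap k Q c =
      algebraMap (MvPolynomial (Fin n) k ⧸ I) Q (Ideal.Quotient.mk I (MvPolynomial.C c)))
    (hLQ' : ∀ l, algebraMap (residueFieldOfPrime p) Q' l =
      algebraMap (MvPolynomial (Fin n) (residueFieldOfPrime p) ⧸ I') Q'
        (Ideal.Quotient.mk I' (MvPolynomial.C l))) :
    Module.finrank k Q =
      Module.finrank k (residueFieldOfPrime p) * Module.finrank (residueFieldOfPrime p) Q' := by
  have : IsLocalRing Q := IsLocalization.AtPrime.isLocalRing Q (p.map (Ideal.Quotient.mk I))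
  have : IsLocalRing Q' :=
    IsLocalization.AtPrime.isLocalRing Q' ((canonicalPointAbove p).map (Ideal.Quotient.mk I'))
  have : IsNoetherianRing Q' := IsLocalization.isNoetherianRing
    ((canonicalPointAbove p).map (Ideal.Quotient.mk I')).primeCompl Q' inferInstance
  let j : MvPolynomial (Fin n) k →+* Q :=
    (algebraMap (MvPolynomial (Fin n) k ⧸ I) Q).comp (Ideal.Quotient.mk I)
  let j' : MvPolynomial (Fin n) (residueFieldOfPrime p) →+* Q' :=
    (algebraMap (MvPolynomial (Fin n) (residueFieldOfPrime p) ⧸ I') Q').comp (Ideal.Quotient.mk I')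
  have hj'0 : ∀ x ∈ I', j' x = 0 := fun x hx => by
    simp [j', Ideal.Quotient.eq_zero_iff_mem.2 hx]
  have hj0 : ∀ x ∈ I, j x = 0 := fun x hx => by
    simp [j, Ideal.Quotient.eq_zero_iff_mem.2 hx]
  have hj'unit : ∀ x ∉ canonicalPointAbove p, IsUnit (j' x) := fun x hx =>
    IsLocalization.map_units Q' (⟨_, mk_notMem_map_quotientMk hIp' hx⟩ :
      ((canonicalPointAbove p).map (Ideal.Quotient.mk I')).primeCompl)
  let ev : MvPolynomial (Fin n) (residueFieldOfPrime p) →+* residueFieldOfPrime p :=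
    MvPolynomial.eval fun i => toResidueFieldOfPrime p (MvPolynomial.X i)
  have hev : ∀ x, x ∈ canonicalPointAbove p ↔ ev x = 0 := fun x => by
    rw [canonicalPointAbove, RingHom.mem_ker]
    exact Iff.rfl
  let bc : MvPolynomial (Fin n) k →+* MvPolynomial (Fin n) (residueFieldOfPrime p) :=
    MvPolynomial.map (algebraMap k (residueFieldOfPrime p))
  have hevbc : ev.comp bc = toResidueFieldOfPrime p := by
    refine MvPolynomial.ringHom_ext (fun c => ?_) fun i => ?_
    · simp only [ev, bc, RingHom.comp_apply, MvPolynomial.map_C, MvPolynomial.eval_C]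
      rfl
    · simp [ev, bc]
  have hbc0 : ∀ x ∈ I, bc x ∈ I' := by
    rw [← hI, ← hI']
    intro x hx
    have := Ideal.mem_map_of_mem bc hx
    rwa [Ideal.map_span, ← Set.range_comp] at this
  -- the residue maps
  obtain ⟨π, hπ⟩ := exists_ringHom_of_quotient_localization (p := p) Q
    (toResidueFieldOfPrime p) (fun x hx => toResidueFieldOfPrime_eq_zero_iff.2 (hIp hx))
    fun x hx => isUnit_iff_ne_zero.2 (mt toResidueFieldOfPrime_eq_zero_iff.1 hx)
  obtain ⟨π', hπ'⟩ := exists_ringHom_of_quotient_localization (p := canonicalPointAbove p) Q'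
    ev (fun x hx => (hev x).1 (hIp' hx)) fun x hx => isUnit_iff_ne_zero.2 (mt (hev x).2 hx)
  -- the base change map
  obtain ⟨φ, hφ⟩ := exists_ringHom_of_quotient_localization (p := p) Q (j'.comp bc)
    (fun x hx => hj'0 _ (hbc0 x hx)) fun x hx => hj'unit _ fun h => hx <| by
      rwa [hev, ← RingHom.comp_apply, hevbc, toResidueFieldOfPrime_eq_zero_iff] at h
  have hφC : ∀ c, φ (algebraMap k Q c) =
      algebraMap (residueFieldOfPrime p) Q' (algebraMap k (residueFieldOfPrime p) c) := fun c => by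
    rw [hkQ, hφ, hLQ', RingHom.comp_apply]
    simp [bc, j']
  have hπsurj : Function.Surjective π := fun l => by
    obtain ⟨x, y, hy, h⟩ := exists_toResidueFieldOfPrime_mul_eq l
    have hy0 : toResidueFieldOfPrime p y ≠ 0 := mt toResidueFieldOfPrime_eq_zero_iff.1 hy
    have hu := IsLocalization.map_units Q
      (⟨_, mk_notMem_map_quotientMk hIp hy⟩ : (p.map (Ideal.Quotient.mk I)).primeCompl)
    obtain ⟨u, hu⟩ := hu
    refine ⟨j x * ↑u⁻¹, mul_right_cancel₀ hy0 ?_⟩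
    rw [h, ← hπ y, ← hπ x, ← map_mul, mul_assoc]
    erw [← hu]
    simp [j]
  have hlocal : IsLocalHom π := IsLocalHom.of_surjective π hπsurj
  have hπC : ∀ c, π (algebraMap k Q c) = algebraMap k (residueFieldOfPrime p) c := fun c => by
    rw [hkQ, hπ]
    rfl
  have hπ'C : ∀ l, π' (algebraMap (residueFieldOfPrime p) Q' l) = l := fun l => by
    rw [hLQ', hπ']
    simp [ev]
  refine finrank_eq_finrank_mul_finrank_of_section
    (isNilpotent_maximalIdeal_of_isOpen Q hIp hI hiso)
    (π := { π with commutes' := hπC })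
    (π' := { π' with commutes' := hπ'C })
    hπsurj φ hφC ?_ ?_ ?_
  · refine DFunLike.congr_fun (f := π'.comp φ) (g := π)
      (ringHom_ext_of_quotient_localization (I := I) p fun x => ?_)
    rw [RingHom.comp_apply, hφ, hπ, ← hevbc]
    exact hπ' _
  · intro s hs
    let g : MvPolynomial (Fin n) (residueFieldOfPrime p) →+* Q :=
      MvPolynomial.eval₂Hom s.toRingHom fun i => j (MvPolynomial.X i)
    have hgbc : g.comp bc = j := by
      refine MvPolynomial.ringHom_ext (fun c => ?_) fun i => ?_
      · simpa [g, bc, j] using hkQ c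
      · simp [g, bc]
    have hπg : π.comp g = ev := by
      refine MvPolynomial.ringHom_ext (fun c => ?_) fun i => ?_
      · simpa [g, ev] using hs c
      · simpa [g, ev, j] using hπ _
    have hg0 : I' ≤ RingHom.ker g := by
      rw [← hI', Ideal.span_le]
      rintro _ ⟨i, rfl⟩
      change (g.comp bc) (f i) = 0
      rw [hgbc]
      exact hj0 _ (hI ▸ Ideal.subset_span ⟨i, rfl⟩)
    obtain ⟨ψ, hψ⟩ := exists_ringHom_of_quotient_localization (p := canonicalPointAbove p) Q' g hg0
      fun x hx => isUnit_of_map_unit π _ <| by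
        rw [← RingHom.comp_apply, hπg]
        exact isUnit_iff_ne_zero.2 (mt (hev x).2 hx)
    refine ⟨ψ, fun l => ?_, ?_⟩
    · rw [hLQ', hψ]
      simp [g]
    · refine DFunLike.congr_fun (f := ψ.comp φ) (g := RingHom.id Q)
        (ringHom_ext_of_quotient_localization (I := I) p fun x => ?_)
      rw [RingHom.comp_apply, hφ, RingHom.comp_apply]
      exact (hψ _).trans (DFunLike.congr_fun hgbc x)
  · intro g hgL hgφ
    refine ringHom_ext_of_quotient_localization (I := I') (canonicalPointAbove p) fun x => ?_
    refine DFunLike.congr_fun (f := g.comp j') (g := j')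
      (MvPolynomial.ringHom_ext (fun l => ?_) fun i => ?_) x
    · exact (congrArg g (hLQ' l).symm).trans ((hgL l).trans (hLQ' l))
    · have h : φ (j (MvPolynomial.X i)) = j' (MvPolynomial.X i) := by
        change φ (algebraMap _ Q (Ideal.Quotient.mk I _)) = _
        rw [hφ]
        simp [bc]
      rw [RingHom.comp_apply, ← h, hgφ]

set_option synthInstance.maxHeartbeats 1000000 in
set_option maxHeartbeats 2000000 in
/-- Let `p ⊆ k[x₁,…,xₙ]` be a prime containing `f₁,…,fₙ`, isolated in the zero locus
`V(f₁,…,fₙ)`, whose residue field `L = κ(p)` is finite and separable over `k`.  Let `p̃`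
be the canonical `L`-rational point above `p`, and let
`Q = (k[x]/(f))_p` and `Q̃ = (L[x]/(f^L))_{p̃}` be the local algebras.  Then
`dim_k Q = [L : k] · dim_L Q̃`. -/
theorem finrank_local_algebra_eq_finrank_mul
    (k : Type) [Field k] (n : ℕ) (f : Fin n → MvPolynomial (Fin n) k)
    (p : Ideal (MvPolynomial (Fin n) k)) [p.IsPrime] (hfp : ∀ i, f i ∈ p)
    [FiniteDimensional k (residueFieldOfPrime p)]
    [Algebra.IsSeparable k (residueFieldOfPrime p)]
    (hiso : IsOpen {x : PrimeSpectrum.zeroLocus (Set.range f) | x.1.asIdeal = p}) :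
    -- the local algebra `Q = (k[x₁,…,xₙ]/(f₁,…,fₙ))_p` over `k`
    haveI hq : (p.map (Ideal.Quotient.mk (Ideal.span (Set.range f)))).IsPrime :=
      Ideal.map_isPrime_of_surjective Ideal.Quotient.mk_surjective
        (by rw [Ideal.mk_ker]; exact Ideal.span_le.mpr (Set.range_subset_iff.mpr hfp))
    letI Q := Localization.AtPrime (p.map (Ideal.Quotient.mk (Ideal.span (Set.range f))))
    letI : Algebra k Q :=
      ((algebraMap (MvPolynomial (Fin n) k ⧸ Ideal.span (Set.range f)) Q).comp
        (algebraMap k (MvPolynomial (Fin n) k ⧸ Ideal.span (Set.range f)))).toAlgebra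
    -- the local algebra `Q̃ = (L[x₁,…,xₙ]/(f₁^L,…,fₙ^L))_{p̃}` over `L = κ(p)`
    haveI hq' : ((canonicalPointAbove p).map (Ideal.Quotient.mk (Ideal.span (Set.range
        fun i => MvPolynomial.map (algebraMap k (residueFieldOfPrime p)) (f i))))).IsPrime :=
      Ideal.map_isPrime_of_surjective Ideal.Quotient.mk_surjective
        (by rw [Ideal.mk_ker]
            exact Ideal.span_le.mpr (Set.range_subset_iff.mpr
              (map_mem_canonicalPointAbove p hfp)))
    letI Q' := Localization.AtPrime ((canonicalPointAbove p).map (Ideal.Quotient.mk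
      (Ideal.span (Set.range
        fun i => MvPolynomial.map (algebraMap k (residueFieldOfPrime p)) (f i)))))
    letI : Algebra (residueFieldOfPrime p) Q' :=
      ((algebraMap (MvPolynomial (Fin n) (residueFieldOfPrime p) ⧸ Ideal.span (Set.range
          fun i => MvPolynomial.map (algebraMap k (residueFieldOfPrime p)) (f i))) Q').comp
        (algebraMap (residueFieldOfPrime p)
          (MvPolynomial (Fin n) (residueFieldOfPrime p) ⧸ Ideal.span (Set.range
            fun i => MvPolynomial.map (algebraMap k (residueFieldOfPrime p)) (f i))))).toAlgebra
    -- the equality of ranks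
    Module.finrank k Q =
      Module.finrank k (residueFieldOfPrime p) * Module.finrank (residueFieldOfPrime p) Q' := by
  have hI := Ideal.span_le.mpr (Set.range_subset_iff.mpr hfp)
  have hI' := Ideal.span_le.mpr (Set.range_subset_iff.mpr (map_mem_canonicalPointAbove p hfp))
  have hq := Ideal.map_isPrime_of_surjective (I := p)
    Ideal.Quotient.mk_surjective (Ideal.mk_ker.trans_le hI)
  have hq' := Ideal.map_isPrime_of_surjective (I := canonicalPointAbove p)
    Ideal.Quotient.mk_surjective (Ideal.mk_ker.trans_le hI')
  refine finrank_eq_finrank_mul_finrank_of_isLocalization hiso rfl hI rfl hI'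
    (Q := Localization.AtPrime (p.map (Ideal.Quotient.mk (Ideal.span (Set.range f)))))
    (Q' := Localization.AtPrime ((canonicalPointAbove p).map (Ideal.Quotient.mk (Ideal.span
      (Set.range fun i => MvPolynomial.map (algebraMap k (residueFieldOfPrime p)) (f i))))))
    ?_ ?_ <;>
  exact fun _ => rfl
end
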